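/- Let G = (V, E) be a legal dag with |In(G)| = t. Then there exist t pairwise edge-disjoint directed paths in G, each starting at a vertex of In(G) and ending at a vertex of Out(G). -/

import Mathlib

open Finset

variable {V : Type} [Fintype V] [DecidableEq V]

/-- The in-degree of a vertex `v` in the digraph with edge set `E`. -/
def dIn (E : Finset (V × V)) (v : V) : ℕ :=
  (univ.filter fun u => (u, v) ∈ E).card

/-- The out-degree of a vertex `v` in the digraph with edge set `E`. -/
def dOut (E : Finset (V × V)) (v : V) : ℕ :=
  (univ.filter fun u => (v, u) ∈ E).card

/-- The set of input vertices: vertices of in-degree 0. -/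
def InSet (E : Finset (V × V)) : Finset V :=
  univ.filter fun v => dIn E v = 0

/-- The set of output vertices: vertices of out-degree 0. -/
def OutSet (E : Finset (V × V)) : Finset V :=
  univ.filter fun v => dOut E v = 0

/-- A digraph is a dag when there is no directed cycle. -/
def IsDag (E : Finset (V × V)) : Prop :=
  ∀ v : V, ¬ Relation.TransGen (fun a b : V => (a, b) ∈ E) v v

/-- A legal dag: a nonempty dag in which inputs have out-degree 1, outputs have
in-degree 1, and all other vertices are balanced. -/
def IsLegal (E : Finset (V × V)) : Prop :=
  E ≠ ∅ ∧ IsDag E ∧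
    (∀ v ∈ InSet E, dOut E v = 1) ∧
    (∀ v ∈ OutSet E, dIn E v = 1) ∧
    (∀ v : V, v ∉ InSet E → v ∉ OutSet E → dIn E v = dOut E v)

/-- A directed path: a nonempty list of pairwise distinct vertices in which
consecutive vertices are joined by an edge. -/
def IsDiPath (E : Finset (V × V)) (p : List V) : Prop :=
  p ≠ [] ∧ p.Nodup ∧ p.Chain' (fun a b : V => (a, b) ∈ E)

/-- The list of edges traversed by a path. -/
def pathEdges (p : List V) : List (V × V) :=
  p.zip p.tail

theorem dOut_erase {E : Finset (V × V)} {a b : V} (h : (a, b) ∈ E) (v : V) :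
    dOut (E.erase (a, b)) v + (if v = a then 1 else 0) = dOut E v := by
  unfold dOut
  split_ifs with hv
  · subst hv
    have : (univ.filter fun u => (v, u) ∈ E.erase (v, b)) =
        (univ.filter fun u => (v, u) ∈ E).erase b := by
      ext u; simp
    rw [this, card_erase_add_one (by simpa using h)]
  · simp [hv]

theorem dIn_erase {E : Finset (V × V)} {a b : V} (h : (a, b) ∈ E) (v : V) :
    dIn (E.erase (a, b)) v + (if v = b then 1 else 0) = dIn E v := by
  unfold dIn
  split_ifs with hv
  · subst hv
    have : (univ.filter fun u => (u, v) ∈ E.erase (a, v)) =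
        (univ.filter fun u => (u, v) ∈ E).erase a := by
      ext u; simp
    rw [this, card_erase_add_one (by simpa using h)]
  · simp [hv]

theorem card_filter_update_eq {ι α : Type*} [Fintype ι] [DecidableEq ι] [DecidableEq α]
    (s : ι → α) (i : ι) (w v : α) :
    (univ.filter fun j => Function.update s i w j = v).card + (if v = s i then 1 else 0) =
      (univ.filter fun j => s j = v).card + (if v = w then 1 else 0) := by
  simp only [card_filter]
  rw [← add_sum_erase univ _ (mem_univ i),
    ← add_sum_erase univ (fun j => if s j = v then 1 else 0) (mem_univ i)]
  have : ∑ j ∈ univ.erase i, (if Function.update s i w j = v then 1 else 0) =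
      ∑ j ∈ univ.erase i, (if s j = v then 1 else 0) :=
    sum_congr rfl fun j hj => by rw [Function.update_of_ne (ne_of_mem_erase hj)]
  rw [this]
  simp only [Function.update_self, eq_comm (a := v)]
  omega

theorem mem_of_mem_pathEdges {α : Type} {E : Finset (α × α)} {p : List α}
    (hp : p.IsChain fun a b => (a, b) ∈ E) {e : α × α} (he : e ∈ pathEdges p) : e ∈ E := by
  induction p with
  | nil => simp [pathEdges] at he
  | cons a p ih =>
    cases p with
    | nil => simp [pathEdges] at he
    | cons b p =>
      rw [List.isChain_cons_cons] at hp
      simp only [pathEdges, List.tail_cons, List.zip_cons_cons, List.mem_cons] at he ih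
      rcases he with rfl | he
      · exact hp.1
      · exact ih hp.2 he

theorem IsDag.nodup {α : Type} {E : Finset (α × α)} (hE : IsDag E) {p : List α}
    (hp : p.IsChain fun a b => (a, b) ∈ E) : p.Nodup := by
  have h : p.IsChain (Relation.TransGen fun a b => (a, b) ∈ E) :=
    hp.imp fun _ _ => Relation.TransGen.single
  refine h.pairwise.imp ?_
  rintro a _ hab rfl
  exact hE a hab

/-- Tokens placed at the vertices `s i` can be moved along pairwise edge-disjoint walks into `T`
as soon as every vertex outside `T` has enough outgoing edges for the tokens
it holds and those which may enter it. -/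
theorem exists_edge_disjoint_walks {ι : Type*} [Fintype ι] [DecidableEq ι] (T : Finset V)
    (E : Finset (V × V)) (s : ι → V)
    (hs : ∀ v ∉ T, dIn E v + (univ.filter fun i => s i = v).card ≤ dOut E v) :
    ∃ P : ι → List V,
      (∀ i, (P i).IsChain (fun a b => (a, b) ∈ E) ∧ (P i).head? = some (s i) ∧
        ∃ w ∈ T, (P i).getLast? = some w) ∧
      ∀ i j, i ≠ j → ∀ e ∈ pathEdges (P i), e ∉ pathEdges (P j) := by
  induction hn : E.card generalizing E s with
  | zero =>
    refine ⟨fun i => [s i], fun i => ⟨by simp, by simp, s i, ?_, by simp⟩, by simp [pathEdges]⟩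
    by_contra hi
    have h := hs _ hi
    have hpos : 0 < (univ.filter fun j => s j = s i).card := card_pos.2 ⟨i, by simp⟩
    have : dOut E (s i) = 0 := by simp [dOut, card_eq_zero.1 hn]
    omega
  | succ n ih =>
    by_cases hT : ∀ i, s i ∈ T
    · exact ⟨fun i => [s i], fun i => ⟨by simp, by simp, s i, hT i, by simp⟩, by simp [pathEdges]⟩
    push Not at hT
    obtain ⟨i, hi⟩ := hT
    have hpos : 0 < (univ.filter fun j => s j = s i).card := card_pos.2 ⟨i, by simp⟩
    obtain ⟨w, hw⟩ : ∃ w, (s i, w) ∈ E := by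
      have : 0 < dOut E (s i) := by have := hs _ hi; omega
      obtain ⟨w, hw⟩ := card_pos.1 this
      exact ⟨w, by simpa using hw⟩
    obtain ⟨P, hP, hd⟩ := ih (E.erase (s i, w)) (Function.update s i w)
      (fun v hv => by
        have h1 := dOut_erase hw v
        have h2 := dIn_erase hw v
        have h3 := card_filter_update_eq s i w v
        have h4 := hs v hv
        omega)
      (by rw [card_erase_of_mem hw, hn]; rfl)
    have hmem : ∀ j, (s i, w) ∉ pathEdges (P j) := fun j h => by
      simpa using mem_of_mem_pathEdges (hP j).1 h
    have hchain : ∀ j, (P j).IsChain fun a b => (a, b) ∈ E := fun j =>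
      (hP j).1.imp fun _ _ => mem_of_mem_erase
    obtain ⟨q, hq⟩ : ∃ q, P i = w :: q := by
      have := (hP i).2.1
      rw [Function.update_self] at this
      exact ⟨_, (List.eq_cons_of_mem_head? this)⟩
    have hedges : ∀ j, ∀ e ∈ pathEdges (Function.update P i (s i :: P i) j),
        (j = i ∧ e = (s i, w)) ∨ e ∈ pathEdges (P j) := by
      intro j e he
      rcases eq_or_ne j i with rfl | hj
      · rw [Function.update_self, hq] at he
        simpa [pathEdges, hq] using he
      · rw [Function.update_of_ne hj] at he
        exact Or.inr he
    refine ⟨Function.update P i (s i :: P i), fun j => ?_, fun j k hjk e hj hk => ?_⟩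
    · rcases eq_or_ne j i with rfl | hj
      · obtain ⟨-, -, x, hx, hl⟩ := hP j
        have hc := hchain j
        rw [Function.update_self]
        rw [hq] at hl hc ⊢
        exact ⟨List.isChain_cons_cons.2 ⟨hw, hc⟩, rfl, x, hx, by simpa using hl⟩
      · have := (hP j).2
        rw [Function.update_of_ne hj] at this ⊢
        exact ⟨hchain j, this⟩
    · rcases hedges j e hj with ⟨rfl, rfl⟩ | hj' <;> rcases hedges k _ hk with ⟨rfl, h⟩ | hk'
      · exact hjk rfl
      · exact hmem _ hk'
      · exact hmem _ (h ▸ hj')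
      · exact hd j k hjk e hj' hk'

/-- A legal dag with `t` input vertices contains `t` pairwise
edge-disjoint directed paths, each from an input vertex to an output vertex. -/
theorem exists_edge_disjoint_paths (E : Finset (V × V)) (t : ℕ)
    (hlegal : IsLegal E) (hcard : (InSet E).card = t) :
    ∃ P : Fin t → List V,
      (∀ i, IsDiPath E (P i) ∧
        (∃ u ∈ InSet E, (P i).head? = some u) ∧
        (∃ w ∈ OutSet E, (P i).getLast? = some w)) ∧
      (∀ i j, i ≠ j →
        ∀ e : V × V, e ∈ pathEdges (P i) → e ∉ pathEdges (P j)) := by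
  obtain ⟨-, hdag, hin, -, hbal⟩ := hlegal
  let f : Fin t ≃ InSet E := (Fintype.equivFinOfCardEq (by simpa using hcard)).symm
  obtain ⟨P, hP, hd⟩ := exists_edge_disjoint_walks (OutSet E) E (fun i => (f i : V)) (by
    intro v hv
    by_cases hvin : v ∈ InSet E
    · have h0 : dIn E v = 0 := by simpa [InSet] using hvin
      have h1 : (univ.filter fun i => (f i : V) = v).card ≤ 1 :=
        card_le_one.2 fun i hi j hj => f.injective <| Subtype.ext <| by
          rw [(mem_filter.1 hi).2, (mem_filter.1 hj).2]
      have := hin v hvin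
      omega
    · have h0 : (univ.filter fun i => (f i : V) = v) = ∅ :=
        filter_eq_empty_iff.2 fun i _ h => hvin (h ▸ (f i).2)
      rw [h0, card_empty, hbal v hvin hv, add_zero])
  refine ⟨P, fun i => ?_, hd⟩
  obtain ⟨hc, hh, hl⟩ := hP i
  refine ⟨⟨?_, hdag.nodup hc, hc⟩, ⟨f i, (f i).2, hh⟩, hl⟩
  rintro h
  simp [h] at hh
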